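/- Let σ ∈ S_m and let n be a nonnegative integer. Then the sum over all involutions π in I_{n+m}(σ) of q^{maj(π^{>m})} equals the sum over all j in the j-set J(σ), with k = n - m + j, of q^{maj(σ^{>j})} · [n choose k]_q · t_k(q). -/

import Mathlib

open Finset

namespace QT

/-- The major index of a permutation of `Fin n` (sum of descents,
with positions written `1,...,n-1` as in one-line notation). -/
def maj {n : ℕ} (π : Equiv.Perm (Fin n)) : ℕ :=
  ∑ i ∈ Finset.range n,
    if h : i + 1 < n then
      (if π ⟨i + 1, h⟩ < π ⟨i, by omega⟩ then i + 1 else 0)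
    else 0

/-- `imaj π = maj π⁻¹`. -/
def imaj {n : ℕ} (π : Equiv.Perm (Fin n)) : ℕ := maj π⁻¹

/-- The permutation of `Fin k` order-isomorphic to the word `v 0, v 1, ..., v (k-1)`. -/
noncomputable def standardize {n k : ℕ} (v : Fin k → Fin n) (hv : Function.Injective v) :
    Equiv.Perm (Fin k) :=
  Equiv.ofBijective
    (fun i => (Finset.orderIsoOfFin (Finset.image v Finset.univ)
        (by rw [Finset.card_image_of_injective _ hv, Finset.card_univ, Fintype.card_fin])).symm
        ⟨v i, Finset.mem_image_of_mem v (Finset.mem_univ i)⟩)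
    (Finite.injective_iff_bijective.mp (fun i j hij => by
      have h2 := (Finset.orderIsoOfFin _ _).symm.injective hij
      exact hv (congrArg Subtype.val h2)))

/-- `π^{≤k}` : the permutation of `Fin k` order-isomorphic to the first `k` letters of `π`. -/
noncomputable def pInit {n : ℕ} (π : Equiv.Perm (Fin n)) (k : ℕ) (hk : k ≤ n) :
    Equiv.Perm (Fin k) :=
  standardize (fun i => π (Fin.castLE hk i))
    (fun i j h => Fin.castLE_injective hk (π.injective h))

/-- `π^{>k}` : the permutation of `Fin (n-k)` order-isomorphic to the last `n - k` letters of `π`. -/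
noncomputable def pTail {n : ℕ} (π : Equiv.Perm (Fin n)) (k : ℕ) :
    Equiv.Perm (Fin (n - k)) :=
  standardize (fun i => π ⟨k + (i : ℕ), by have := i.isLt; omega⟩)
    (fun i j h => by
      have h2 : k + (i : ℕ) = k + (j : ℕ) := congrArg Fin.val (π.injective h)
      exact Fin.ext (by omega))

/-- `π_{≤k}` : the permutation of `Fin k` order-isomorphic to the subword of `π`
consisting of the `k` smallest values.  (Equivalently `((π⁻¹)^{≤k})⁻¹`.) -/
noncomputable def vLow {n : ℕ} (π : Equiv.Perm (Fin n)) (k : ℕ) (hk : k ≤ n) :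
    Equiv.Perm (Fin k) := (pInit π⁻¹ k hk)⁻¹

/-- `π_{>k}` : the permutation of `Fin (n-k)` order-isomorphic to the subword of `π`
consisting of the values `> k`.  (Equivalently `((π⁻¹)^{>k})⁻¹`.) -/
noncomputable def vHigh {n : ℕ} (π : Equiv.Perm (Fin n)) (k : ℕ) :
    Equiv.Perm (Fin (n - k)) := (pTail π⁻¹ k)⁻¹

/-- The set `I_n` of involutions in `S_n`. -/
def involutions (n : ℕ) : Finset (Equiv.Perm (Fin n)) :=
  Finset.univ.filter fun π => π * π = 1

-- `I_n(σ) = {π ∈ I_n : π_{≤m} = σ}`.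
open scoped Classical in
noncomputable def involutionsC (n : ℕ) {m : ℕ} (σ : Equiv.Perm (Fin m)) :
    Finset (Equiv.Perm (Fin n)) :=
  (involutions n).filter fun π => ∃ h : m ≤ n, vLow π m h = σ

-- `S_n(σ,τ) = {π ∈ S_n : π_{≤a} = σ, π^{≤b} = τ}`.
open scoped Classical in
noncomputable def permsC (n : ℕ) {a b : ℕ} (σ : Equiv.Perm (Fin a)) (τ : Equiv.Perm (Fin b)) :
    Finset (Equiv.Perm (Fin n)) :=
  Finset.univ.filter fun π => ∃ (ha : a ≤ n) (hb : b ≤ n), vLow π a ha = σ ∧ pInit π b hb = τ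

-- The j-set `J(σ) = {j : σ^{≤j} is an involution}`.
open scoped Classical in
noncomputable def jSet {m : ℕ} (σ : Equiv.Perm (Fin m)) : Finset ℕ :=
  (Finset.range (m + 1)).filter fun j => ∃ h : j ≤ m, pInit σ j h * pInit σ j h = 1

-- The j₂-set `J(σ,τ) = {j : σ^{≤j} = τ_{≤j}}`.
open scoped Classical in
noncomputable def j2Set {a b : ℕ} (σ : Equiv.Perm (Fin a)) (τ : Equiv.Perm (Fin b)) :
    Finset ℕ :=
  (Finset.range (min a b + 1)).filter fun j =>
    ∃ (ha : j ≤ a) (hb : j ≤ b), pInit σ j ha = vLow τ j hb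

/-- A set of nonnegative integers is a j₂-set if it is `J(σ,τ)` for some pair of
permutations. -/
def IsJ2Set (S : Finset ℕ) : Prop :=
  ∃ (a b : ℕ) (σ : Equiv.Perm (Fin a)) (τ : Equiv.Perm (Fin b)), S = j2Set σ τ

-- The number of j₂-sets with largest element `n`.
open scoped Classical in
noncomputable def j2count (n : ℕ) : ℕ :=
  ((Finset.range (n + 1)).powerset.filter
    fun S => IsJ2Set S ∧ n ∈ S ∧ ∀ x ∈ S, x ≤ n).card

/-- `[n]_q = 1 + q + ⋯ + q^{n-1}`. -/
def qInt (q : ℝ) (n : ℕ) : ℝ := ∑ i ∈ Finset.range n, q ^ i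

/-- The q-factorial `[n]_q! = ∏_{i=1}^n (1 + q + ⋯ + q^{i-1})`. -/
def qFact (q : ℝ) (n : ℕ) : ℝ := ∏ i ∈ Finset.range n, qInt q (i + 1)

/-- The Gaussian binomial coefficient `[n choose k]_q = [n]_q!/([k]_q! [n-k]_q!)`,
defined via the q-Pascal recursion. -/
def qBinom (q : ℝ) : ℕ → ℕ → ℝ
  | _, 0 => 1
  | 0, _ + 1 => 0
  | n + 1, k + 1 => qBinom q n k + q ^ (k + 1) * qBinom q n (k + 1)

/-- `t_n(q) = Σ_{π ∈ I_n} q^{maj π}`. -/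
noncomputable def tq (q : ℝ) (n : ℕ) : ℝ := ∑ π ∈ involutions n, q ^ maj π

/-- `A_n(p,q) = Σ_{π ∈ S_n} p^{imaj π} q^{maj π}`. -/
noncomputable def Apq (p q : ℝ) (n : ℕ) : ℝ :=
  ∑ π : Equiv.Perm (Fin n), p ^ imaj π * q ^ maj π


/-- The major index of the word `f 0, f 1, ..., f (n-1)`. -/
def wordMaj (f : ℕ → ℕ) (n : ℕ) : ℕ :=
  ∑ i ∈ Finset.range (n - 1), if f (i + 1) < f i then i + 1 else 0

theorem maj_eq_wordMaj {k : ℕ} (ρ : Equiv.Perm (Fin k)) (f : ℕ → ℕ)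
    (h : ∀ i i' : Fin k, ρ i < ρ i' ↔ f i < f i') : maj ρ = wordMaj f k := by
  unfold maj wordMaj
  rcases k with _ | k
  · simp
  rw [Finset.sum_range_succ]
  simp only [lt_self_iff_false, dite_false, add_zero, Nat.add_sub_cancel]
  refine Finset.sum_congr rfl fun i hi => ?_
  have hi' : i + 1 < k + 1 := by simpa using hi
  rw [dif_pos hi']
  simp only [h]

theorem wordMaj_congr {f g : ℕ → ℕ} {n : ℕ}
    (h : ∀ i, i + 1 < n → (f (i + 1) < f i ↔ g (i + 1) < g i)) :
    wordMaj f n = wordMaj g n := by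
  refine Finset.sum_congr rfl fun i hi => ?_
  have hi' : i + 1 < n := by
    have := Finset.mem_range.mp hi
    omega
  simp only [h i hi']

theorem wordMaj_succ_succ (f : ℕ → ℕ) (n : ℕ) :
    wordMaj f (n + 2) = wordMaj f (n + 1) + if f (n + 1) < f n then n + 1 else 0 := by
  simp [wordMaj, Finset.sum_range_succ]

/-- The shuffle of the words `u` and `v` in which the letters of `v` occupy the positions in `A`. -/
def shuffle (u v : ℕ → ℕ) (A : Finset ℕ) (i : ℕ) : ℕ :=
  if i ∈ A then v (Nat.count (· ∈ A) i) else u (Nat.count (· ∉ A) i)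

theorem count_mem_of_powersetCard {A : Finset ℕ} {a b : ℕ}
    (hA : A ∈ powersetCard b (range (a + b))) :
    Nat.count (· ∈ A) (a + b) = b ∧ Nat.count (· ∉ A) (a + b) = a := by
  rw [Finset.mem_powersetCard] at hA
  obtain ⟨hs, hc⟩ := hA
  have h1 : Nat.count (· ∈ A) (a + b) = b := by
    rw [Nat.count_eq_card_filter_range, Finset.filter_mem_eq_inter,
      Finset.inter_eq_right.mpr hs, hc]
  have h2 : Nat.count (· ∈ A) (a + b) + Nat.count (· ∉ A) (a + b) = a + b := by
    rw [Nat.count_eq_card_filter_range, Nat.count_eq_card_filter_range,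
      Finset.card_filter_add_card_filter_not, Finset.card_range]
  omega

theorem shuffle_insert_of_lt (u v : ℕ → ℕ) (A : Finset ℕ) {N i : ℕ} (hi : i < N) :
    shuffle u v (insert N A) i = shuffle u v A i := by
  have hc : ∀ x < i, (x ∈ insert N A ↔ x ∈ A) := fun x hx => by
    simp [show x ≠ N by omega]
  have h1 : Nat.count (· ∈ insert N A) i = Nat.count (· ∈ A) i := by
    simp only [Nat.count_eq_card_filter_range]
    exact congrArg _ (Finset.filter_congr fun x hx => hc x (by simpa using hx))
  have h2 : Nat.count (· ∉ insert N A) i = Nat.count (· ∉ A) i := by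
    simp only [Nat.count_eq_card_filter_range]
    exact congrArg _ (Finset.filter_congr fun x hx => not_congr (hc x (by simpa using hx)))
  have h3 : i ∈ insert N A ↔ i ∈ A := by simp [show i ≠ N by omega]
  unfold shuffle
  rw [h1, h2]
  simp only [h3]

theorem wordMaj_shuffle_insert (u v : ℕ → ℕ) (A : Finset ℕ) (N : ℕ) :
    wordMaj (shuffle u v (insert N A)) N = wordMaj (shuffle u v A) N :=
  wordMaj_congr fun i hi => by
    rw [shuffle_insert_of_lt u v A hi, shuffle_insert_of_lt u v A (by omega)]

theorem shuffle_last_of_mem_powersetCard (u v : ℕ → ℕ) {A : Finset ℕ} {a b : ℕ}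
    (hA : A ∈ powersetCard b (range (a + b))) :
    shuffle u v A (a + b) = u a ∧ shuffle u v (insert (a + b) A) (a + b) = v b := by
  have hn : a + b ∉ A := fun h => by
    simpa using (Finset.mem_powersetCard.mp hA).1 h
  obtain ⟨h1, h2⟩ := count_mem_of_powersetCard hA
  constructor
  · simp [shuffle, hn, h2]
  · have h3 : Nat.count (· ∈ insert (a + b) A) (a + b) = Nat.count (· ∈ A) (a + b) := by
      simp only [Nat.count_eq_card_filter_range]
      exact congrArg _ (Finset.filter_congr fun x hx => by
        have : x < a + b := by simpa using hx
        simp [show x ≠ a + b by omega])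
    unfold shuffle
    rw [if_pos (Finset.mem_insert_self _ _), h3, h1]

theorem sum_powersetCard_range_succ (F : Finset ℕ → ℝ) (b N : ℕ) :
    ∑ A ∈ powersetCard (b + 1) (range (N + 1)), F A =
      ∑ A ∈ powersetCard (b + 1) (range N), F A +
        ∑ A ∈ powersetCard b (range N), F (insert N A) := by
  have hN : N ∉ range N := by simp
  have hmem : ∀ {c : ℕ} {A : Finset ℕ}, A ∈ powersetCard c (range N) → N ∉ A := fun hA h =>
    hN ((Finset.mem_powersetCard.mp hA).1 h)
  rw [Finset.range_add_one, Finset.powersetCard_succ_insert hN, Finset.sum_union,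
    Finset.sum_image]
  · intro A hA A' hA' h
    have := congrArg (fun s => Finset.erase s N) h
    simpa [Finset.erase_insert (hmem hA), Finset.erase_insert (hmem hA')] using this
  · rw [Finset.disjoint_left]
    intro A hA hA'
    obtain ⟨A', -, rfl⟩ := Finset.mem_image.mp hA'
    exact hmem hA (Finset.mem_insert_self _ _)

theorem qBinom_eq_zero_of_lt (q : ℝ) : ∀ {n k : ℕ}, n < k → qBinom q n k = 0
  | _, 0, h => absurd h (by omega)
  | 0, _ + 1, _ => by simp [qBinom]
  | n + 1, k + 1, h => by
    simp [qBinom, qBinom_eq_zero_of_lt q (show n < k by omega),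
      qBinom_eq_zero_of_lt q (show n < k + 1 by omega)]

theorem qBinom_self (q : ℝ) : ∀ n : ℕ, qBinom q n n = 1
  | 0 => by simp [qBinom]
  | n + 1 => by simp [qBinom, qBinom_self q n, qBinom_eq_zero_of_lt q (show n < n + 1 by omega)]

theorem qBinom_zero_right (q : ℝ) (n : ℕ) : qBinom q n 0 = 1 := by
  cases n <;> rfl

theorem qBinom_add_succ (q : ℝ) (a b : ℕ) :
    qBinom q (a + 1 + (b + 1)) (b + 1) =
      qBinom q (a + 1 + b) b + q ^ (b + 1) * qBinom q (a + (b + 1)) (b + 1) := by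
  have h : a + (b + 1) = a + 1 + b := by omega
  rw [h]
  rfl

theorem one_sub_pow_mul_qBinom (q : ℝ) (a b : ℕ) :
    (1 - q ^ (a + 1)) * qBinom q (a + 1 + b) b =
      (1 - q ^ (b + 1)) * qBinom q (a + (b + 1)) (b + 1) := by
  induction a generalizing b with
  | zero =>
    rw [show qBinom q (0 + (b + 1)) (b + 1) = 1 by rw [zero_add, qBinom_self]]
    induction b with
    | zero => simp [qBinom_zero_right]
    | succ b ih =>
      rw [qBinom_add_succ, show qBinom q (0 + (b + 1)) (b + 1) = 1 by rw [zero_add, qBinom_self]]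
      linear_combination ih
  | succ a iha =>
    induction b with
    | zero =>
      have h := iha 0
      have h' := qBinom_add_succ q a 0
      simp only [qBinom_zero_right] at h h' ⊢
      rw [h']
      linear_combination q * h
    | succ b ihb =>
      have h := iha (b + 1)
      rw [qBinom_add_succ q (a + 1) b, qBinom_add_succ q a (b + 1)]
      linear_combination ihb + q ^ (b + 2) * h

theorem qBinom_add_succ' (q : ℝ) (a b : ℕ) :
    qBinom q (a + 1 + (b + 1)) (b + 1) =
      q ^ (a + 1) * qBinom q (a + 1 + b) b + qBinom q (a + (b + 1)) (b + 1) := by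
  rw [qBinom_add_succ]
  linear_combination one_sub_pow_mul_qBinom q a b

theorem mem_powersetCard_range_left {A : Finset ℕ} {a b : ℕ}
    (hA : A ∈ powersetCard b (range (a + b))) : A ∈ powersetCard b (range (a + 1 + b)) := by
  rw [Finset.mem_powersetCard] at hA ⊢
  exact ⟨hA.1.trans (Finset.range_mono (by omega)), hA.2⟩

theorem insert_mem_powersetCard_range {A : Finset ℕ} {a b : ℕ}
    (hA : A ∈ powersetCard b (range (a + b))) :
    insert (a + b) A ∈ powersetCard (b + 1) (range (a + (b + 1))) := by
  rw [Finset.mem_powersetCard] at hA ⊢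
  refine ⟨?_, ?_⟩
  · rw [← add_assoc, Finset.range_add_one]
    exact Finset.insert_subset_insert _ hA.1
  · rw [Finset.card_insert_of_notMem, hA.2]
    exact fun h => by simpa using hA.1 h

theorem wordMaj_shuffle_left_left (u v : ℕ → ℕ) {A : Finset ℕ} {a b : ℕ}
    (hA : A ∈ powersetCard b (range (a + b))) :
    wordMaj (shuffle u v A) (a + 1 + b + 1) =
      wordMaj (shuffle u v A) (a + b + 1) + if u (a + 1) < u a then a + b + 1 else 0 := by
  rw [← (shuffle_last_of_mem_powersetCard u v hA).1,
    ← (shuffle_last_of_mem_powersetCard u v (mem_powersetCard_range_left hA)).1,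
    show a + 1 + b = a + b + 1 by omega]
  exact wordMaj_succ_succ _ _

theorem wordMaj_shuffle_right_left (u v : ℕ → ℕ) {A : Finset ℕ} {a b : ℕ}
    (hA : A ∈ powersetCard b (range (a + b))) (h : u a < v b) :
    wordMaj (shuffle u v (insert (a + b) A)) (a + (b + 1) + 1) =
      wordMaj (shuffle u v (insert (a + b) A)) (a + b + 1) + (a + b + 1) := by
  have h1 := (shuffle_last_of_mem_powersetCard u v hA).2
  have h2 := (shuffle_last_of_mem_powersetCard u v (insert_mem_powersetCard_range hA)).1
  rw [← h1, ← h2] at h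
  exact (wordMaj_succ_succ _ (a + b)).trans (congrArg _ (if_pos h))

theorem wordMaj_shuffle_left_right (u v : ℕ → ℕ) {A : Finset ℕ} {a b : ℕ}
    (hA : A ∈ powersetCard b (range (a + b))) (h : u a < v b) :
    wordMaj (shuffle u v (insert (a + 1 + b) A)) (a + 1 + b + 1) =
      wordMaj (shuffle u v A) (a + b + 1) := by
  have h1 := (shuffle_last_of_mem_powersetCard u v hA).1
  have h2 := (shuffle_last_of_mem_powersetCard u v (mem_powersetCard_range_left hA)).2
  rw [show a + 1 + b = a + b + 1 by omega] at *
  rw [← h1, ← h2, ← shuffle_insert_of_lt u v A (Nat.lt_succ_self (a + b))] at h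
  refine (wordMaj_succ_succ _ _).trans ?_
  rw [if_neg (not_lt.mpr h.le), wordMaj_shuffle_insert, add_zero]

theorem wordMaj_shuffle_right_right (u v : ℕ → ℕ) {A : Finset ℕ} {a b : ℕ}
    (hA : A ∈ powersetCard b (range (a + b))) :
    wordMaj (shuffle u v (insert (a + (b + 1)) (insert (a + b) A))) (a + (b + 1) + 1) =
      wordMaj (shuffle u v (insert (a + b) A)) (a + b + 1) +
        if v (b + 1) < v b then a + b + 1 else 0 := by
  rw [← (shuffle_last_of_mem_powersetCard u v hA).2,
    ← (shuffle_last_of_mem_powersetCard u v (insert_mem_powersetCard_range hA)).2,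
    ← shuffle_insert_of_lt u v (insert (a + b) A) (show a + b < a + (b + 1) by omega),
    ← wordMaj_shuffle_insert u v (insert (a + b) A) (a + b + 1)]
  exact wordMaj_succ_succ _ _

theorem sum_powersetCard_range_add_succ (F : Finset ℕ → ℝ) (a b : ℕ) :
    ∑ A ∈ powersetCard (b + 1) (range (a + 1 + (b + 1))), F A =
      ∑ A ∈ powersetCard (b + 1) (range (a + (b + 1))), F A +
        ∑ A ∈ powersetCard b (range (a + 1 + b)), F (insert (a + 1 + b) A) := by
  rw [show a + (b + 1) = a + 1 + b by omega]
  exact sum_powersetCard_range_succ F b (a + 1 + b)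

theorem sum_powersetCard_range_zero_add_succ (F : Finset ℕ → ℝ) (b : ℕ) :
    ∑ A ∈ powersetCard (b + 1) (range (0 + (b + 1))), F A =
      ∑ A ∈ powersetCard b (range (0 + b)), F (insert (0 + b) A) := by
  rw [← add_assoc, sum_powersetCard_range_succ, Finset.powersetCard_eq_empty.mpr (by simp)]
  simp

/-- Sums over the shuffles of two words, all letters of the first being smaller than all letters
of the second, split according to the word which contributes the last letter. -/
theorem sum_shuffle_last (q : ℝ) (u v : ℕ → ℕ) (a' b' : ℕ)
    (huv : ∀ i < a', ∀ j < b', u i < v j) (a b : ℕ) :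
    (a + 1 ≤ a' → b ≤ b' →
      ∑ A ∈ powersetCard b (range (a + b)), q ^ wordMaj (shuffle u v A) (a + b + 1) =
        q ^ (wordMaj u (a + 1) + wordMaj v b) * (q ^ b * qBinom q (a + b) b)) ∧
    (a ≤ a' → b + 1 ≤ b' →
      ∑ A ∈ powersetCard b (range (a + b)),
          q ^ wordMaj (shuffle u v (insert (a + b) A)) (a + b + 1) =
        q ^ (wordMaj u a + wordMaj v (b + 1)) * qBinom q (a + b) b) := by
  have ll : ∀ a b : ℕ, ∑ A ∈ powersetCard b (range (a + b)),
      q ^ wordMaj (shuffle u v A) (a + 1 + b + 1) =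
      (∑ A ∈ powersetCard b (range (a + b)), q ^ wordMaj (shuffle u v A) (a + b + 1)) *
        q ^ (if u (a + 1) < u a then a + b + 1 else 0) := fun a b => by
    rw [Finset.sum_mul]
    exact Finset.sum_congr rfl fun A hA => by rw [wordMaj_shuffle_left_left u v hA, pow_add]
  have rl : ∀ a b : ℕ, u a < v b → ∑ A ∈ powersetCard b (range (a + b)),
      q ^ wordMaj (shuffle u v (insert (a + b) A)) (a + (b + 1) + 1) =
      (∑ A ∈ powersetCard b (range (a + b)),
        q ^ wordMaj (shuffle u v (insert (a + b) A)) (a + b + 1)) *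
        q ^ (a + b + 1) := fun a b h => by
    rw [Finset.sum_mul]
    exact Finset.sum_congr rfl fun A hA => by rw [wordMaj_shuffle_right_left u v hA h, pow_add]
  have lr : ∀ a b : ℕ, u a < v b → ∑ A ∈ powersetCard b (range (a + b)),
      q ^ wordMaj (shuffle u v (insert (a + 1 + b) A)) (a + 1 + b + 1) =
      ∑ A ∈ powersetCard b (range (a + b)), q ^ wordMaj (shuffle u v A) (a + b + 1) :=
    fun a b h => Finset.sum_congr rfl fun A hA => by rw [wordMaj_shuffle_left_right u v hA h]
  have rr : ∀ a b : ℕ, ∑ A ∈ powersetCard b (range (a + b)),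
      q ^ wordMaj (shuffle u v (insert (a + (b + 1)) (insert (a + b) A))) (a + (b + 1) + 1) =
      (∑ A ∈ powersetCard b (range (a + b)),
        q ^ wordMaj (shuffle u v (insert (a + b) A)) (a + b + 1)) *
        q ^ (if v (b + 1) < v b then a + b + 1 else 0) := fun a b => by
    rw [Finset.sum_mul]
    exact Finset.sum_congr rfl fun A hA => by rw [wordMaj_shuffle_right_right u v hA, pow_add]
  induction hN : a + b using Nat.strong_induction_on generalizing a b with
  | h N ih =>
  subst hN
  rcases a with _ | a <;> rcases b with _ | b
  · simp [qBinom, wordMaj]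
  · obtain ⟨-, ihr⟩ := ih (0 + b) (by omega) 0 b rfl
    constructor
    · intro ha hb
      rw [sum_powersetCard_range_zero_add_succ, rl 0 b (huv _ (by omega) _ (by omega)),
        ihr (by omega) (by omega)]
      simp only [zero_add, qBinom_self, wordMaj]
      simp
    · intro ha hb
      rw [sum_powersetCard_range_zero_add_succ, rr, ihr (by omega) (by omega),
        wordMaj_succ_succ v b]
      simp only [zero_add, qBinom_self]
      ring
  · obtain ⟨ihl, -⟩ := ih (a + 0) (by omega) a 0 rfl
    have hz : ∀ F : Finset ℕ → ℝ, ∑ A ∈ powersetCard 0 (range (a + 1 + 0)), F A =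
      ∑ A ∈ powersetCard 0 (range (a + 0)), F A := fun F => by simp
    constructor
    · intro ha hb
      rw [hz, ll, ihl (by omega) (by omega), wordMaj_succ_succ u a]
      simp only [qBinom_zero_right, add_zero]
      ring
    · intro ha hb
      rw [hz, lr a 0 (huv _ (by omega) _ (by omega)), ihl (by omega) (by omega)]
      simp [qBinom_zero_right, wordMaj]
  · obtain ⟨ihl, -⟩ := ih (a + (b + 1)) (by omega) a (b + 1) rfl
    obtain ⟨-, ihr⟩ := ih (a + 1 + b) (by omega) (a + 1) b rfl
    constructor
    · intro ha hb
      rw [sum_powersetCard_range_add_succ, ll, rl (a + 1) b (huv _ (by omega) _ (by omega)),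
        ihl (by omega) (by omega), ihr (by omega) (by omega), wordMaj_succ_succ u a]
      split_ifs
      · rw [qBinom_add_succ]
        ring
      · rw [qBinom_add_succ']
        ring
    · intro ha hb
      rw [sum_powersetCard_range_add_succ, rr, lr a (b + 1) (huv _ (by omega) _ (by omega)),
        ihl (by omega) (by omega), ihr (by omega) (by omega), wordMaj_succ_succ v b]
      split_ifs
      · rw [qBinom_add_succ']
        ring
      · rw [qBinom_add_succ]
        ring

theorem sum_shuffle (q : ℝ) (u v : ℕ → ℕ) (a b : ℕ) (huv : ∀ i < a, ∀ j < b, u i < v j) :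
    ∑ A ∈ powersetCard b (range (a + b)), q ^ wordMaj (shuffle u v A) (a + b) =
      q ^ (wordMaj u a + wordMaj v b) * qBinom q (a + b) b := by
  rcases a with _ | a <;> rcases b with _ | b
  · simp [qBinom, wordMaj]
  · rw [sum_powersetCard_range_zero_add_succ]
    refine ((sum_shuffle_last q u v 0 (b + 1) huv 0 b).2 le_rfl le_rfl).trans ?_
    simp only [zero_add, qBinom_self]
  · have h := (sum_shuffle_last q u v (a + 1) 0 huv a 0).1 le_rfl le_rfl
    simp only [qBinom_zero_right] at h ⊢
    simpa using h
  · have hl := (sum_shuffle_last q u v (a + 1) (b + 1) huv a (b + 1)).1 le_rfl le_rfl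
    have hr := (sum_shuffle_last q u v (a + 1) (b + 1) huv (a + 1) b).2 le_rfl le_rfl
    have e : a + 1 + (b + 1) = a + (b + 1) + 1 := by omega
    rw [sum_powersetCard_range_add_succ]
    refine (congrArg₂ (· + ·) ((Finset.sum_congr rfl fun A _ => by rw [e]).trans hl) hr).trans ?_
    rw [qBinom_add_succ]
    ring

theorem orderEmbOfFin_standardize {n k : ℕ} (v : Fin k → Fin n) (hv : Function.Injective v)
    (h : (Finset.image v Finset.univ).card = k) (i : Fin k) :
    (Finset.image v Finset.univ).orderEmbOfFin h (standardize v hv i) = v i := by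
  simp [standardize, ← Finset.coe_orderIsoOfFin_apply]

theorem standardize_lt_iff {n k : ℕ} (v : Fin k → Fin n) (hv : Function.Injective v)
    (i j : Fin k) : standardize v hv i < standardize v hv j ↔ v i < v j := by
  simp [standardize]

/-- A permutation is determined by the relative order of its letters. -/
theorem perm_eq_of_lt_iff {k : ℕ} {ρ τ : Equiv.Perm (Fin k)}
    (h : ∀ i j, ρ i < ρ j ↔ τ i < τ j) : ρ = τ := by
  have hm : StrictMono (ρ * τ⁻¹) := fun i j hij => by
    simpa [Equiv.Perm.mul_apply, h] using hij
  have h1 : ⇑(ρ * τ⁻¹) = ⇑(1 : Equiv.Perm (Fin k)) :=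
    (StrictMono.range_inj hm strictMono_id).mp (by simp)
  exact mul_inv_eq_one.mp (Equiv.coe_fn_injective h1)

theorem mem_involutionsC_iff {m n : ℕ} (σ : Equiv.Perm (Fin m)) (π : Equiv.Perm (Fin (n + m))) :
    π ∈ involutionsC (n + m) σ ↔ π * π = 1 ∧
      StrictMono fun r : Fin m => π (Fin.castLE (Nat.le_add_left m n) (σ r)) := by
  simp only [involutionsC, involutions, Finset.mem_filter, Finset.mem_univ, true_and,
    Nat.le_add_left, exists_true_left, vLow]
  refine and_congr_right fun hπ => ?_
  rw [inv_eq_of_mul_eq_one_right hπ, inv_eq_iff_eq_inv]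
  constructor
  · intro h r s hrs
    have h1 : pInit π m (Nat.le_add_left m n) (σ r) < pInit π m (Nat.le_add_left m n) (σ s) := by
      simpa [h] using hrs
    exact (standardize_lt_iff _ _ (σ r) (σ s)).mp h1
  · intro h
    refine perm_eq_of_lt_iff fun i j => (standardize_lt_iff _ _ i j).trans ?_
    simpa using h.lt_iff_lt (a := σ⁻¹ i) (b := σ⁻¹ j)

theorem maj_pTail_eq_wordMaj {n : ℕ} (π : Equiv.Perm (Fin n)) (k l : ℕ) (hl : n - k = l)
    (f : ℕ → ℕ)
    (h : ∀ i j (hi : k + i < n) (hj : k + j < n), π ⟨k + i, hi⟩ < π ⟨k + j, hj⟩ ↔ f i < f j) :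
    maj (pTail π k) = wordMaj f l := by
  subst hl
  exact maj_eq_wordMaj _ _ fun i j => (standardize_lt_iff _ _ i j).trans (h i j _ _)

theorem count_mem_orderEmbOfFin {A : Finset ℕ} {k : ℕ} (hA : A.card = k) (r : Fin k) :
    Nat.count (· ∈ A) (A.orderEmbOfFin hA r) = r := by
  have : (range (A.orderEmbOfFin hA r)).filter (· ∈ A) =
      (Finset.Iio r).image (A.orderEmbOfFin hA) := by
    ext x
    simp only [Finset.mem_filter, Finset.mem_range, Finset.mem_image, Finset.mem_Iio]
    constructor
    · rintro ⟨hx, hxA⟩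
      have : x ∈ Set.range (A.orderEmbOfFin hA) := by simpa using hxA
      obtain ⟨s, rfl⟩ := this
      exact ⟨s, by simpa using hx, rfl⟩
    · rintro ⟨s, hs, rfl⟩
      exact ⟨by simpa using hs, Finset.orderEmbOfFin_mem _ _ _⟩
  rw [Nat.count_eq_card_filter_range, this,
    Finset.card_image_of_injective _ (A.orderEmbOfFin hA).injective, Fin.card_Iio]

theorem exists_orderEmbOfFin_eq {A : Finset ℕ} {k x : ℕ} (hA : A.card = k) (hx : x ∈ A) :
    ∃ r, A.orderEmbOfFin hA r = x := by
  have : x ∈ Set.range (A.orderEmbOfFin hA) := by simpa using hx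
  exact this

theorem count_notMem_orderEmbOfFin_sdiff {A : Finset ℕ} {n l : ℕ}
    (hC : (range n \ A).card = l) (r : Fin l) :
    Nat.count (· ∉ A) ((range n \ A).orderEmbOfFin hC r) = r := by
  refine Eq.trans ?_ (count_mem_orderEmbOfFin hC r)
  rw [Nat.count_eq_card_filter_range, Nat.count_eq_card_filter_range]
  refine congrArg _ (Finset.filter_congr fun x hx => ?_)
  have h := Finset.mem_sdiff.mp (Finset.orderEmbOfFin_mem (range n \ A) hC r)
  simp only [Finset.mem_range] at hx h
  simp [hx.trans h.1]

theorem card_image_initial {m j : ℕ} (σ : Equiv.Perm (Fin m)) (h : j ≤ m) :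
    (Finset.image (fun i : Fin j => σ (Fin.castLE h i)) Finset.univ).card = j := by
  rw [Finset.card_image_of_injective _ fun a b hab => Fin.castLE_injective h (σ.injective hab),
    Finset.card_univ, Fintype.card_fin]

/-- The increasing enumeration of the set formed by the first `j` letters of `σ`. -/
noncomputable def initialEnum {m j : ℕ} (σ : Equiv.Perm (Fin m)) (h : j ≤ m) : Fin j ↪o Fin m :=
  (Finset.image (fun i : Fin j => σ (Fin.castLE h i)) Finset.univ).orderEmbOfFin
    (card_image_initial σ h)

theorem initialEnum_pInit {m j : ℕ} (σ : Equiv.Perm (Fin m)) (h : j ≤ m) (r : Fin j) :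
    initialEnum σ h (pInit σ j h r) = σ (Fin.castLE h r) :=
  orderEmbOfFin_standardize _ _ _ r

theorem eq_initialEnum {m j : ℕ} (σ : Equiv.Perm (Fin m)) (h : j ≤ m) (g : Fin j → Fin m)
    (hg : StrictMono g) (hgm : ∀ r, σ⁻¹ (g r) < j) : g = initialEnum σ h := by
  refine Finset.orderEmbOfFin_unique _ (fun r => Finset.mem_image.mpr ?_) hg
  exact ⟨⟨σ⁻¹ (g r), hgm r⟩, Finset.mem_univ _, by simp⟩

section Assembled

variable {j k l : ℕ}

/-- The involution `π` is assembled from the permutation `σ` of `[j + l]`, the involution `τ` of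
`[k]` and the set `A`: it permutes the first `j` letters of `σ`, it exchanges the last `l` letters
of `σ` with the positions `j + l + c` for `c ∈ C` monotonically, and it acts as `τ` on the
positions `j + l + a` for `a ∈ A`, where `C` is the complement of `A` in `{0, ..., l + k - 1}`. -/
structure IsAssembled (σ : Equiv.Perm (Fin (j + l))) (τ : Equiv.Perm (Fin k)) (A : Finset ℕ)
    (hA : A.card = k) (hC : (range (l + k) \ A).card = l)
    (π : Equiv.Perm (Fin (l + k + (j + l)))) : Prop where
  mul_self : π * π = 1
  initial (r : Fin j) (x : Fin (l + k + (j + l))) :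
    (x : ℕ) = σ (Fin.castLE (Nat.le_add_right j l) r) →
      (π x : ℕ) = initialEnum σ (Nat.le_add_right j l) r
  final (r : Fin l) (x : Fin (l + k + (j + l))) : (x : ℕ) = σ (Fin.natAdd j r) →
      (π x : ℕ) = j + l + (range (l + k) \ A).orderEmbOfFin hC r
  high (r : Fin k) (x : Fin (l + k + (j + l))) : (x : ℕ) = j + l + A.orderEmbOfFin hA r →
      (π x : ℕ) = j + l + A.orderEmbOfFin hA (τ r)

theorem position_cases (σ : Equiv.Perm (Fin (j + l))) (A : Finset ℕ)
    (hA : A.card = k) (hC : (range (l + k) \ A).card = l) (x : Fin (l + k + (j + l))) :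
    (∃ r : Fin j, (x : ℕ) = σ (Fin.castLE (Nat.le_add_right j l) r)) ∨
    (∃ r : Fin l, (x : ℕ) = σ (Fin.natAdd j r)) ∨
    (∃ r : Fin l, (x : ℕ) = j + l + (range (l + k) \ A).orderEmbOfFin hC r) ∨
    (∃ r : Fin k, (x : ℕ) = j + l + A.orderEmbOfFin hA r) := by
  by_cases hx : (x : ℕ) < j + l
  · obtain ⟨s, hs⟩ := σ.surjective ⟨x, hx⟩
    have hs' : (x : ℕ) = σ s := by rw [hs]
    induction s using Fin.addCases with
    | left r => exact Or.inl ⟨r, hs'⟩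
    | right r => exact Or.inr (Or.inl ⟨r, hs'⟩)
  · have hx' : (x : ℕ) - (j + l) < l + k := by omega
    by_cases hxA : (x : ℕ) - (j + l) ∈ A
    · obtain ⟨r, hr⟩ := exists_orderEmbOfFin_eq hA hxA
      exact Or.inr (Or.inr (Or.inr ⟨r, by omega⟩))
    · obtain ⟨r, hr⟩ := exists_orderEmbOfFin_eq hC
        (Finset.mem_sdiff.mpr ⟨Finset.mem_range.mpr hx', hxA⟩)
      exact Or.inr (Or.inr (Or.inl ⟨r, by omega⟩))

namespace IsAssembled

variable {σ : Equiv.Perm (Fin (j + l))} {τ : Equiv.Perm (Fin k)} {A : Finset ℕ}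
  {hA : A.card = k} {hC : (range (l + k) \ A).card = l}
  {π : Equiv.Perm (Fin (l + k + (j + l)))}

theorem apply_apply (h : IsAssembled σ τ A hA hC π) (x : Fin (l + k + (j + l))) :
    π (π x) = x := by
  simpa using congrArg (fun ρ => ρ x) h.mul_self

theorem complement (h : IsAssembled σ τ A hA hC π) (r : Fin l) (x : Fin (l + k + (j + l)))
    (hx : (x : ℕ) = j + l + (range (l + k) \ A).orderEmbOfFin hC r) :
    (π x : ℕ) = σ (Fin.natAdd j r) := by
  have h1 := h.final r (Fin.castLE (Nat.le_add_left _ _) (σ (Fin.natAdd j r))) rfl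
  rw [← hx] at h1
  rw [← Fin.ext h1, h.apply_apply]
  rfl

theorem eq {π' : Equiv.Perm (Fin (l + k + (j + l)))} (h : IsAssembled σ τ A hA hC π)
    (h' : IsAssembled σ τ A hA hC π') : π = π' := by
  ext x
  rcases position_cases σ A hA hC x with ⟨r, hr⟩ | ⟨r, hr⟩ | ⟨r, hr⟩ | ⟨r, hr⟩
  · rw [h.initial r x hr, h'.initial r x hr]
  · rw [h.final r x hr, h'.final r x hr]
  · rw [h.complement r x hr, h'.complement r x hr]
  · rw [h.high r x hr, h'.high r x hr]

theorem mem_iff (h : IsAssembled σ τ A hA hC π) (hs : A ⊆ range (l + k)) (p : ℕ) :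
    p ∈ A ↔ ∃ hp : j + l + p < l + k + (j + l), j + l ≤ (π ⟨j + l + p, hp⟩ : ℕ) := by
  constructor
  · intro hp
    have hp' := Finset.mem_range.mp (hs hp)
    obtain ⟨r, hr⟩ := exists_orderEmbOfFin_eq hA hp
    refine ⟨by omega, ?_⟩
    rw [h.high r _ (by simp [hr])]
    omega
  · rintro ⟨hp, hp'⟩
    by_contra hpA
    obtain ⟨r, hr⟩ := exists_orderEmbOfFin_eq hC
      (Finset.mem_sdiff.mpr ⟨Finset.mem_range.mpr (by omega : p < l + k), hpA⟩)
    rw [h.complement r _ (by simp [hr])] at hp'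
    have := (σ (Fin.natAdd j r)).isLt
    omega

theorem eq_of_perm {τ' : Equiv.Perm (Fin k)} (hs : A ⊆ range (l + k))
    (h : IsAssembled σ τ A hA hC π) (h' : IsAssembled σ τ' A hA hC π) : τ = τ' := by
  refine Equiv.ext fun r => ?_
  have hr : A.orderEmbOfFin hA r < l + k :=
    Finset.mem_range.mp (hs (Finset.orderEmbOfFin_mem A hA r))
  have h1 := h.high r ⟨j + l + A.orderEmbOfFin hA r, by omega⟩ rfl
  have h2 := h'.high r ⟨j + l + A.orderEmbOfFin hA r, by omega⟩ rfl
  exact (A.orderEmbOfFin hA).injective (by omega)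

theorem strictMono (h : IsAssembled σ τ A hA hC π) :
    StrictMono fun r => π (Fin.castLE (Nat.le_add_left (j + l) (l + k)) (σ r)) := by
  intro r s hrs
  rw [Fin.lt_def]
  induction r using Fin.addCases with
  | left r =>
    have hr := h.initial r (Fin.castLE (Nat.le_add_left _ _) (σ (Fin.castAdd l r))) rfl
    induction s using Fin.addCases with
    | left s =>
      have hs := h.initial s (Fin.castLE (Nat.le_add_left _ _) (σ (Fin.castAdd l s))) rfl
      simp only [hr, hs]
      exact (initialEnum σ (Nat.le_add_right j l)).strictMono (show r < s from hrs)
    | right s =>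
      have hs := h.final s (Fin.castLE (Nat.le_add_left _ _) (σ (Fin.natAdd j s))) rfl
      simp only [hr, hs]
      have := (initialEnum σ (Nat.le_add_right j l) r).isLt
      omega
  | right r =>
    have hr := h.final r (Fin.castLE (Nat.le_add_left _ _) (σ (Fin.natAdd j r))) rfl
    induction s using Fin.addCases with
    | left s =>
      simp [Fin.lt_def] at hrs
      omega
    | right s =>
      have hs := h.final s (Fin.castLE (Nat.le_add_left _ _) (σ (Fin.natAdd j s))) rfl
      simp only [hr, hs]
      simpa using hrs

theorem lt_iff (h : IsAssembled σ τ A hA hC π) (r : Fin (j + l)) :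
    (π (Fin.castLE (Nat.le_add_left (j + l) (l + k)) (σ r)) : ℕ) < j + l ↔ (r : ℕ) < j := by
  induction r using Fin.addCases with
  | left r =>
    rw [h.initial r _ rfl]
    simp
  | right r =>
    rw [h.final r _ rfl]
    simp

/-- The tail of an assembled involution is a shuffle of `τ` with the end of `σ`. -/
theorem maj_pTail (h : IsAssembled σ τ A hA hC π) (u v : ℕ → ℕ)
    (hu : ∀ r : Fin l, u r = σ (Fin.natAdd j r)) (hv : ∀ r : Fin k, v r = j + l + τ r) :
    maj (pTail π (j + l)) = wordMaj (shuffle u v A) (l + k) := by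
  refine maj_pTail_eq_wordMaj π (j + l) (l + k) (by omega) _ fun p p' hp hp' => ?_
  have key : ∀ p (hp : j + l + p < l + k + (j + l)),
      (∃ r : Fin k, p ∈ A ∧ (π ⟨j + l + p, hp⟩ : ℕ) = j + l + A.orderEmbOfFin hA (τ r) ∧
        shuffle u v A p = j + l + τ r) ∨
      ((π ⟨j + l + p, hp⟩ : ℕ) < j + l ∧
        shuffle u v A p = π ⟨j + l + p, hp⟩) := by
    intro p hp
    by_cases hpA : p ∈ A
    · obtain ⟨r, rfl⟩ := exists_orderEmbOfFin_eq hA hpA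
      refine Or.inl ⟨r, hpA, h.high r _ rfl, ?_⟩
      rw [shuffle, if_pos hpA, count_mem_orderEmbOfFin, hv]
    · obtain ⟨r, rfl⟩ := exists_orderEmbOfFin_eq hC
        (Finset.mem_sdiff.mpr ⟨Finset.mem_range.mpr (by omega : p < l + k), hpA⟩)
      have h1 := h.complement r ⟨_, hp⟩ rfl
      refine Or.inr ⟨by rw [h1]; exact Fin.isLt _, ?_⟩
      rw [shuffle, if_neg hpA, count_notMem_orderEmbOfFin_sdiff, hu, h1]
  rw [Fin.lt_def]
  rcases key p hp with ⟨r, -, h1, h2⟩ | ⟨h1, h2⟩ <;>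
    rcases key p' hp' with ⟨r', -, h1', h2'⟩ | ⟨h1', h2'⟩
  · rw [h1, h1', h2, h2', Nat.add_lt_add_iff_left, Nat.add_lt_add_iff_left,
      OrderEmbedding.lt_iff_lt, Fin.lt_def]
  · omega
  · omega
  · omega

end IsAssembled

theorem exists_isAssembled (σ : Equiv.Perm (Fin (j + l)))
    (hσ : pInit σ j (Nat.le_add_right j l) * pInit σ j (Nat.le_add_right j l) = 1)
    (τ : Equiv.Perm (Fin k)) (hτ : τ * τ = 1) (A : Finset ℕ) (hs : A ⊆ range (l + k))
    (hA : A.card = k) (hC : (range (l + k) \ A).card = l) :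
    ∃ π, IsAssembled σ τ A hA hC π := by
  set ρ := pInit σ j (Nat.le_add_right j l) with hρ
  have hρρ : ∀ r, ρ (ρ r) = r := fun r => by simpa using congrArg (fun ρ => ρ r) hσ
  have hττ : ∀ r, τ (τ r) = r := fun r => by simpa using congrArg (fun ρ => ρ r) hτ
  let lo : Fin (j + l) → Fin (l + k + (j + l)) := Fin.castLE (Nat.le_add_left _ _)
  have hγ : ∀ r, (range (l + k) \ A).orderEmbOfFin hC r < l + k := fun r =>
    Finset.mem_range.mp (Finset.mem_sdiff.mp (Finset.orderEmbOfFin_mem _ hC r)).1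
  have hα : ∀ r, A.orderEmbOfFin hA r < l + k := fun r =>
    Finset.mem_range.mp (hs (Finset.orderEmbOfFin_mem _ hA r))
  let e : Fin j ⊕ Fin l ⊕ Fin l ⊕ Fin k → Fin (l + k + (j + l)) :=
    Sum.elim (fun r => lo (initialEnum σ (Nat.le_add_right j l) r))
      (Sum.elim (fun r => lo (σ (Fin.natAdd j r)))
        (Sum.elim (fun r => ⟨j + l + (range (l + k) \ A).orderEmbOfFin hC r, by
            have := hγ r
            omega⟩)
          (fun r => ⟨j + l + A.orderEmbOfFin hA r, by
            have := hα r
            omega⟩)))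
  have he : Function.Bijective e := by
    refine (Fintype.bijective_iff_surjective_and_card e).mpr ⟨fun x => ?_, ?_⟩
    · rcases position_cases σ A hA hC x with ⟨r, hr⟩ | ⟨r, hr⟩ | ⟨r, hr⟩ | ⟨r, hr⟩
      · refine ⟨Sum.inl (ρ r), Fin.ext ?_⟩
        rw [hr, ← initialEnum_pInit]
        rfl
      · exact ⟨Sum.inr (Sum.inl r), Fin.ext hr.symm⟩
      · exact ⟨Sum.inr (Sum.inr (Sum.inl r)), Fin.ext hr.symm⟩
      · exact ⟨Sum.inr (Sum.inr (Sum.inr r)), Fin.ext hr.symm⟩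
    · simp only [Fintype.card_sum, Fintype.card_fin]
      omega
  let s : Fin j ⊕ Fin l ⊕ Fin l ⊕ Fin k → Fin j ⊕ Fin l ⊕ Fin l ⊕ Fin k :=
    Sum.elim (fun r => Sum.inl (ρ r))
      (Sum.elim (fun r => Sum.inr (Sum.inr (Sum.inl r)))
        (Sum.elim (fun r => Sum.inr (Sum.inl r)) (fun r => Sum.inr (Sum.inr (Sum.inr (τ r))))))
  have hss : Function.Involutive s := by
    rintro (r | r | r | r) <;> simp [s, hρρ, hττ]
  let E := Equiv.ofBijective e he
  let π := E.permCongr hss.toPerm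
  have hπ : ∀ z, π (e z) = e (s z) := fun z => by
    have : E.symm (e z) = z := E.symm_apply_apply z
    simp only [π, Equiv.permCongr_apply, this]
    rfl
  have hπx : ∀ (x : Fin (l + k + (j + l))) (z), (x : ℕ) = e z → (π x : ℕ) = e (s z) := fun x z h => by
    rw [Fin.ext h, hπ]
  refine ⟨π, ?_, fun r x hx => ?_, fun r x hx => ?_, fun r x hx => ?_⟩
  · refine Equiv.ext fun x => ?_
    obtain ⟨z, rfl⟩ := he.2 x
    simp [hπ, hss z]
  · refine (hπx x (Sum.inl (ρ r)) ?_).trans ?_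
    · rw [hx, ← initialEnum_pInit]
      rfl
    · simp [e, s, lo, hρρ]
  · exact hπx x (Sum.inr (Sum.inl r)) hx
  · exact hπx x (Sum.inr (Sum.inr (Sum.inr r))) hx

section Disassemble

variable {n : ℕ} {σ : Equiv.Perm (Fin (j + l))} {π : Equiv.Perm (Fin (n + (j + l)))}

theorem apply_initial_eq_initialEnum (hπ : π * π = 1)
    (hm : StrictMono fun r => π (Fin.castLE (Nat.le_add_left (j + l) n) (σ r)))
    (hj : ∀ r, (π (Fin.castLE (Nat.le_add_left (j + l) n) (σ r)) : ℕ) < j + l ↔ (r : ℕ) < j)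
    (r : Fin j) :
    (π (Fin.castLE (Nat.le_add_left (j + l) n) (σ (Fin.castLE (Nat.le_add_right j l) r))) : ℕ) =
      initialEnum σ (Nat.le_add_right j l) r := by
  let g : Fin j → Fin (j + l) := fun r =>
    ⟨π (Fin.castLE (Nat.le_add_left (j + l) n) (σ (Fin.castLE (Nat.le_add_right j l) r))),
      (hj _).mpr r.isLt⟩
  have hg : g = initialEnum σ (Nat.le_add_right j l) := by
    refine eq_initialEnum σ _ g (fun a b hab => ?_) fun r => ?_
    · exact hm (a := Fin.castLE (Nat.le_add_right j l) a)
        (b := Fin.castLE (Nat.le_add_right j l) b) hab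
    · refine (hj _).mp ?_
      have h1 : Fin.castLE (Nat.le_add_left (j + l) n) (σ (σ⁻¹ (g r))) =
          π (Fin.castLE (Nat.le_add_left (j + l) n)
            (σ (Fin.castLE (Nat.le_add_right j l) r))) := by
        rw [Equiv.Perm.inv_def, Equiv.apply_symm_apply]
        rfl
      rw [h1, ← Equiv.Perm.mul_apply, hπ, Equiv.Perm.one_apply]
      exact (σ _).isLt
  exact congrArg Fin.val (congrFun hg r)

theorem pInit_mul_self (hπ : π * π = 1)
    (hm : StrictMono fun r => π (Fin.castLE (Nat.le_add_left (j + l) n) (σ r)))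
    (hj : ∀ r, (π (Fin.castLE (Nat.le_add_left (j + l) n) (σ r)) : ℕ) < j + l ↔ (r : ℕ) < j) :
    pInit σ j (Nat.le_add_right j l) * pInit σ j (Nat.le_add_right j l) = 1 := by
  refine Equiv.ext fun r => ?_
  set ρ := pInit σ j (Nat.le_add_right j l) with hρ
  have h1 : ∀ r, π (Fin.castLE (Nat.le_add_left (j + l) n)
      (initialEnum σ (Nat.le_add_right j l) (ρ r))) =
      Fin.castLE (Nat.le_add_left (j + l) n) (initialEnum σ (Nat.le_add_right j l) r) := fun r => by
    refine Fin.ext ?_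
    rw [hρ, initialEnum_pInit, apply_initial_eq_initialEnum hπ hm hj]
    rfl
  have h2 := congrArg π (h1 (ρ r))
  rw [← Equiv.Perm.mul_apply, hπ, h1] at h2
  simpa using h2

theorem le_of_lt_iff
    (hj : ∀ r, (π (Fin.castLE (Nat.le_add_left (j + l) n) (σ r)) : ℕ) < j + l ↔ (r : ℕ) < j) :
    l ≤ n := by
  have hge : ∀ r : Fin l, j + l ≤
      (π (Fin.castLE (Nat.le_add_left (j + l) n) (σ (Fin.natAdd j r))) : ℕ) := fun r =>
    not_lt.mp fun h => by simpa using (hj _).mp h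
  let f : Fin l → Fin n := fun r =>
    ⟨π (Fin.castLE (Nat.le_add_left (j + l) n) (σ (Fin.natAdd j r))) - (j + l), by
      have := hge r
      omega⟩
  have hf : Function.Injective f := fun a b hab => by
    have h := congrArg Fin.val hab
    have ha := hge a
    have hb := hge b
    simp only [f] at h
    have h1 := Fin.castLE_injective _ (π.injective (Fin.ext (by omega :
      (π (Fin.castLE (Nat.le_add_left (j + l) n) (σ (Fin.natAdd j a))) : ℕ) =
        π (Fin.castLE (Nat.le_add_left (j + l) n) (σ (Fin.natAdd j b))))))
    simpa using h1
  simpa using Fintype.card_le_of_injective f hf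

end Disassemble

theorem exists_isAssembled_of_lt_iff {σ : Equiv.Perm (Fin (j + l))}
    {π : Equiv.Perm (Fin (l + k + (j + l)))} (hπ : π * π = 1)
    (hm : StrictMono fun r => π (Fin.castLE (Nat.le_add_left (j + l) (l + k)) (σ r)))
    (hj : ∀ r, (π (Fin.castLE (Nat.le_add_left (j + l) (l + k)) (σ r)) : ℕ) < j + l ↔
      (r : ℕ) < j) :
    ∃ (τ : Equiv.Perm (Fin k)) (A : Finset ℕ) (hA : A.card = k)
      (hC : (range (l + k) \ A).card = l),
      τ * τ = 1 ∧ A ⊆ range (l + k) ∧ IsAssembled σ τ A hA hC π := by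
  have hππ : ∀ x, π (π x) = x := fun x => by simpa using congrArg (fun ρ => ρ x) hπ
  let lo : Fin (j + l) → Fin (l + k + (j + l)) := Fin.castLE (Nat.le_add_left _ _)
  let d : Fin l → ℕ := fun r => π (lo (σ (Fin.natAdd j r))) - (j + l)
  have hd : ∀ r, (π (lo (σ (Fin.natAdd j r))) : ℕ) = j + l + d r := fun r => by
    have : j + l ≤ (π (lo (σ (Fin.natAdd j r))) : ℕ) :=
      not_lt.mp fun h => by simpa using (hj _).mp h
    simp only [d]
    omega
  have hdm : StrictMono d := fun a b hab => by
    have h1 : π (lo (σ (Fin.natAdd j a))) < π (lo (σ (Fin.natAdd j b))) :=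
      hm ((Fin.natAdd_lt_natAdd_iff j).mpr hab)
    rw [Fin.lt_def, hd, hd] at h1
    omega
  obtain ⟨C, hCd⟩ : ∃ C, C = Finset.univ.image d := ⟨_, rfl⟩
  have hCs : C ⊆ range (l + k) := by
    rw [hCd]
    intro x hx
    obtain ⟨r, -, rfl⟩ := Finset.mem_image.mp hx
    have h1 := hd r
    have h2 := (π (lo (σ (Fin.natAdd j r)))).isLt
    exact Finset.mem_range.mpr (by omega)
  have hCc : C.card = l := by
    rw [hCd, Finset.card_image_of_injective _ hdm.injective, Finset.card_univ, Fintype.card_fin]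
  obtain ⟨A, hAC⟩ : ∃ A, A = range (l + k) \ C := ⟨_, rfl⟩
  have hs : A ⊆ range (l + k) := hAC ▸ Finset.sdiff_subset
  have hA : A.card = k := by
    rw [hAC, Finset.card_sdiff_of_subset hCs, hCc, Finset.card_range]
    omega
  have hCA : range (l + k) \ A = C := by
    rw [hAC, Finset.sdiff_sdiff_eq_self hCs]
  have hC : (range (l + k) \ A).card = l := by rw [hCA, hCc]
  have hdC : d = (range (l + k) \ A).orderEmbOfFin hC :=
    Finset.orderEmbOfFin_unique _ (fun r => by
      rw [hCA, hCd]
      exact Finset.mem_image_of_mem _ (Finset.mem_univ r)) hdm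
  have hmemC : ∀ x : Fin (l + k + (j + l)), ∀ p, (x : ℕ) = j + l + p →
      (p ∈ C ↔ (π x : ℕ) < j + l) := by
    intro x p hx
    rw [hCd]
    constructor
    · intro hp
      obtain ⟨r, -, rfl⟩ := Finset.mem_image.mp hp
      rw [← hd r] at hx
      rw [Fin.ext hx, hππ]
      exact (σ (Fin.natAdd j r)).isLt
    · intro hlt
      obtain ⟨s, hs⟩ := σ.surjective ⟨π x, hlt⟩
      have h1 : lo (σ s) = π x := by
        rw [hs]
        rfl
      have h2 : π (lo (σ s)) = x := by rw [h1, hππ]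
      induction s using Fin.addCases with
      | left r =>
        have h3 := (hj (Fin.castAdd l r)).mpr (by simp)
        change (π (lo (σ (Fin.castAdd l r))) : ℕ) < j + l at h3
        rw [h2] at h3
        omega
      | right r =>
        have h3 := hd r
        rw [h2] at h3
        exact Finset.mem_image.mpr ⟨r, Finset.mem_univ _, by omega⟩
  have hα : ∀ r, A.orderEmbOfFin hA r < l + k ∧ A.orderEmbOfFin hA r ∉ C := fun r => by
    have := (Finset.ext_iff.mp hAC _).mp (Finset.orderEmbOfFin_mem A hA r)
    rwa [Finset.mem_sdiff, Finset.mem_range] at this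
  let hi : Fin k → Fin (l + k + (j + l)) := fun r =>
    ⟨j + l + A.orderEmbOfFin hA r, by
      have := (hα r).1
      omega⟩
  have hex : ∀ r : Fin k, ∃ s : Fin k, π (hi r) = hi s := by
    intro r
    have h1 : j + l ≤ (π (hi r) : ℕ) :=
      not_lt.mp fun h => (hα r).2 ((hmemC (hi r) _ rfl).mpr h)
    have h2 : (π (hi r) : ℕ) - (j + l) ∈ A := by
      rw [hAC, Finset.mem_sdiff, Finset.mem_range]
      refine ⟨by omega, fun h => ?_⟩
      have h3 := (hmemC (π (hi r)) _ (by omega)).mp h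
      rw [hππ] at h3
      simp only [hi] at h3
      omega
    obtain ⟨s, hs⟩ := exists_orderEmbOfFin_eq hA h2
    have h3 : (hi s : ℕ) = j + l + A.orderEmbOfFin hA s := rfl
    exact ⟨s, Fin.ext (by omega)⟩
  choose t ht using hex
  have hhi : Function.Injective hi := fun a b hab => by
    have := congrArg Fin.val hab
    exact (A.orderEmbOfFin hA).injective (by simp only [hi] at this; omega)
  have htt : Function.Involutive t := fun r => hhi (by rw [← ht, ← ht, hππ])
  refine ⟨htt.toPerm, A, hA, hC, Equiv.ext htt, hs, hπ, fun r x hx => ?_, fun r x hx => ?_,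
    fun r x hx => ?_⟩
  · rw [← apply_initial_eq_initialEnum hπ hm hj r, ← Fin.ext (b := Fin.castLE _ _) hx]
  · have : x = lo (σ (Fin.natAdd j r)) := Fin.ext hx
    rw [this, hd, hdC]
  · have : x = hi r := Fin.ext hx
    rw [this, ht]
    rfl

end Assembled

theorem lt_iff_lt_card_filter {m N : ℕ} {g : Fin m → Fin N} (hg : StrictMono g) (c : ℕ)
    (r : Fin m) :
    (g r : ℕ) < c ↔ (r : ℕ) < (Finset.univ.filter fun s : Fin m => (g s : ℕ) < c).card := by
  constructor
  · intro h
    have hsub : Finset.Iic r ⊆ Finset.univ.filter fun s : Fin m => (g s : ℕ) < c := fun s hs => by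
      have h1 : (g s : ℕ) ≤ g r := hg.monotone (Finset.mem_Iic.mp hs)
      exact Finset.mem_filter.mpr ⟨Finset.mem_univ _, by omega⟩
    have := Finset.card_le_card hsub
    rw [Fin.card_Iic] at this
    omega
  · intro h
    by_contra hr
    have hsub : (Finset.univ.filter fun s : Fin m => (g s : ℕ) < c) ⊆ Finset.Iio r := fun s hs => by
      have h1 := (Finset.mem_filter.mp hs).2
      refine Finset.mem_Iio.mpr (hg.lt_iff_lt.mp ?_)
      rw [Fin.lt_def]
      omega
    have := Finset.card_le_card hsub
    rw [Fin.card_Iio] at this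
    omega

/-- The number of positions `i ≤ m` with `π i ≤ m`, counted along the word `σ`. -/
def lowCount {m n : ℕ} (σ : Equiv.Perm (Fin m)) (π : Equiv.Perm (Fin (n + m))) : ℕ :=
  (Finset.univ.filter fun r : Fin m =>
    (π (Fin.castLE (Nat.le_add_left m n) (σ r)) : ℕ) < m).card

theorem lowCount_le {m n : ℕ} (σ : Equiv.Perm (Fin m)) (π : Equiv.Perm (Fin (n + m))) :
    lowCount σ π ≤ m :=
  (Finset.card_le_univ _).trans_eq (Fintype.card_fin m)

theorem lowCount_eq_iff {m n j : ℕ} (hjm : j ≤ m) {σ : Equiv.Perm (Fin m)}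
    {π : Equiv.Perm (Fin (n + m))}
    (hm : StrictMono fun r => π (Fin.castLE (Nat.le_add_left m n) (σ r))) :
    lowCount σ π = j ↔
      ∀ r, (π (Fin.castLE (Nat.le_add_left m n) (σ r)) : ℕ) < m ↔ (r : ℕ) < j := by
  have key : ∀ r, (π (Fin.castLE (Nat.le_add_left m n) (σ r)) : ℕ) < m ↔
      (r : ℕ) < lowCount σ π := lt_iff_lt_card_filter hm m
  constructor
  · rintro rfl
    exact key
  · intro h
    have hle := lowCount_le σ π
    simp only [key] at h
    rcases lt_trichotomy (lowCount σ π) j with h1 | h1 | h1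
    · exact absurd ((h ⟨lowCount σ π, by omega⟩).mpr h1) (lt_irrefl _)
    · exact h1
    · exact absurd ((h ⟨j, by omega⟩).mp h1) (lt_irrefl _)

theorem sum_involutionsC_lowCount_eq {j k l : ℕ} (σ : Equiv.Perm (Fin (j + l)))
    (hσ : pInit σ j (Nat.le_add_right j l) * pInit σ j (Nat.le_add_right j l) = 1) (q : ℝ) :
    ∑ π ∈ (involutionsC (l + k + (j + l)) σ).filter (fun π => lowCount σ π = j),
        q ^ maj (pTail π (j + l)) =
      q ^ maj (pTail σ j) * qBinom q (l + k) k * tq q k := by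
  let u : ℕ → ℕ := fun i => if h : i < l then σ (Fin.natAdd j ⟨i, h⟩) else 0
  let v : Equiv.Perm (Fin k) → ℕ → ℕ := fun τ i => if h : i < k then j + l + τ ⟨i, h⟩ else 0
  have hu : ∀ r : Fin l, u r = σ (Fin.natAdd j r) := fun r => dif_pos r.isLt
  have hv : ∀ τ : Equiv.Perm (Fin k), ∀ r : Fin k, v τ r = j + l + τ r := fun τ r => by simp [v]
  have hmu : maj (pTail σ j) = wordMaj u l := by
    refine maj_pTail_eq_wordMaj σ j l (by omega) u fun a b ha hb => ?_
    rw [hu ⟨a, by omega⟩, hu ⟨b, by omega⟩]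
    rfl
  have hmv : ∀ τ : Equiv.Perm (Fin k), maj τ = wordMaj (v τ) k := fun τ =>
    maj_eq_wordMaj τ _ fun a b => by simp [hv]
  have huv : ∀ τ : Equiv.Perm (Fin k), ∀ a < l, ∀ b < k, u a < v τ b := fun τ a ha b hb => by
    have h1 := hu ⟨a, ha⟩
    have h2 := hv τ ⟨b, hb⟩
    have h3 := (σ (Fin.natAdd j ⟨a, ha⟩)).isLt
    simp only at h1 h2
    omega
  have hrhs : q ^ maj (pTail σ j) * qBinom q (l + k) k * tq q k =
      ∑ x ∈ involutions k ×ˢ powersetCard k (range (l + k)),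
        q ^ wordMaj (shuffle u (v x.1) x.2) (l + k) := by
    rw [Finset.sum_product, tq, Finset.mul_sum]
    refine Finset.sum_congr rfl fun τ _ => ?_
    rw [sum_shuffle q u (v τ) l k (huv τ), hmu, hmv τ, pow_add]
    ring
  have hinv : ∀ τ : Equiv.Perm (Fin k), τ ∈ involutions k ↔ τ * τ = 1 := fun τ => by
    simp [involutions]
  have hex : ∀ x ∈ involutions k ×ˢ powersetCard k (range (l + k)),
      ∃ (hA : x.2.card = k) (hC : (range (l + k) \ x.2).card = l)
        (π : Equiv.Perm (Fin (l + k + (j + l)))), IsAssembled σ x.1 x.2 hA hC π := by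
    intro x hx
    obtain ⟨hτ, hA⟩ := Finset.mem_product.mp hx
    obtain ⟨hs, hA⟩ := Finset.mem_powersetCard.mp hA
    have hC : (range (l + k) \ x.2).card = l := by
      rw [Finset.card_sdiff_of_subset hs, hA, Finset.card_range]
      omega
    exact ⟨hA, hC, exists_isAssembled σ hσ x.1 ((hinv _).mp hτ) x.2 hs hA hC⟩
  choose hA hC F hF using hex
  rw [hrhs]
  symm
  refine Finset.sum_bij F (fun x hx => ?_) (fun x hx y hy hxy => ?_) (fun π hπ => ?_)
    (fun x hx => ?_)
  · have h := hF x hx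
    exact Finset.mem_filter.mpr ⟨(mem_involutionsC_iff σ _).mpr ⟨h.mul_self, h.strictMono⟩,
      (lowCount_eq_iff (Nat.le_add_right j l) h.strictMono).mpr h.lt_iff⟩
  · obtain ⟨τ, A⟩ := x
    obtain ⟨τ', A'⟩ := y
    have h := hF _ hx
    have h' := hF _ hy
    rw [← hxy] at h'
    have hs := (Finset.mem_powersetCard.mp (Finset.mem_product.mp hx).2).1
    have hs' := (Finset.mem_powersetCard.mp (Finset.mem_product.mp hy).2).1
    have hAA : A = A' := Finset.ext fun p => (h.mem_iff hs p).trans (h'.mem_iff hs' p).symm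
    subst hAA
    exact congrArg (·, A) (h.eq_of_perm hs h')
  · obtain ⟨hπ, hj⟩ := Finset.mem_filter.mp hπ
    obtain ⟨hπ, hm⟩ := (mem_involutionsC_iff σ π).mp hπ
    obtain ⟨τ, A, hA', hC', hτ, hs, h⟩ := exists_isAssembled_of_lt_iff hπ hm
      ((lowCount_eq_iff (Nat.le_add_right j l) hm).mp hj)
    have hx : (τ, A) ∈ involutions k ×ˢ powersetCard k (range (l + k)) :=
      Finset.mem_product.mpr ⟨(hinv τ).mpr hτ, Finset.mem_powersetCard.mpr ⟨hs, hA'⟩⟩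
    exact ⟨(τ, A), hx, (hF _ hx).eq h⟩
  · rw [(hF x hx).maj_pTail u (v x.1) hu (hv x.1)]

/-- For `σ ∈ S_m`,
`Σ_{π ∈ I_{n+m}(σ)} q^{maj(π^{>m})} = Σ_{j ∈ J(σ)} q^{maj(σ^{>j})} [n choose k]_q t_k(q)`
with `k = n - m + j` (terms with `k < 0` vanish). -/
theorem stmt1 {m : ℕ} (σ : Equiv.Perm (Fin m)) (n : ℕ) (q : ℝ) :
    ∑ π ∈ involutionsC (n + m) σ, q ^ maj (pTail π m) =
      ∑ j ∈ jSet σ,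
        if m ≤ n + j then
          q ^ maj (pTail σ j) * qBinom q n (n + j - m) * tq q (n + j - m)
        else 0 := by
  classical
  rw [← Finset.sum_fiberwise_of_maps_to (s := involutionsC (n + m) σ) (t := range (m + 1))
      (g := lowCount σ) fun π _ => Finset.mem_range.mpr (Nat.lt_succ_of_le (lowCount_le σ π)),
    jSet, Finset.sum_filter]
  refine Finset.sum_congr rfl fun j hj => ?_
  obtain ⟨l, rfl⟩ := Nat.exists_eq_add_of_le (Nat.lt_succ_iff.mp (Finset.mem_range.mp hj))
  by_cases h : pInit σ j (Nat.le_add_right j l) * pInit σ j (Nat.le_add_right j l) = 1 ∧ l ≤ n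
  · obtain ⟨hσ, hl⟩ := h
    obtain ⟨k, rfl⟩ := Nat.exists_eq_add_of_le hl
    rw [if_pos ⟨_, hσ⟩, if_pos (by omega), show l + k + j - (j + l) = k by omega,
      sum_involutionsC_lowCount_eq σ hσ q]
  · rw [Finset.sum_eq_zero fun π hπ => ?_]
    · split_ifs with h1 h2
      · exact absurd ⟨h1.2, by omega⟩ h
      · rfl
      · rfl
    · obtain ⟨hπ, hj⟩ := Finset.mem_filter.mp hπ
      obtain ⟨hπ, hm⟩ := (mem_involutionsC_iff σ π).mp hπ
      have hj := (lowCount_eq_iff (Nat.le_add_right j l) hm).mp hj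
      exact absurd ⟨pInit_mul_self hπ hm hj, le_of_lt_iff hj⟩ h

end QT
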